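/- Let q be a real number with |q| < 1. Then ∑_{i,j,k ≥ 1} q^{i+j+k} / ((1-q^i)(1-q^j)(1-q^k)(1-q^{i+j+k})) = 6 ∑_{n₁ > n₂ > n₃ ≥ 1} q^{n₁} / ((1-q^{n₁})^2 (1-q^{n₂}) (1-q^{n₃})) - 3 ∑_{n₁ > n₂ ≥ 1} (n₁ - 2) q^{n₁} / ((1-q^{n₁})^2 (1-q^{n₂})) + (1/2) ∑_{n ≥ 1} (n-1)(n-2) q^n/(1-q^n)^2. -/

import Mathlib

open scoped BigOperators

/-- Okounkov's `Z(2) = ∑_{n ≥ 1} qⁿ/(1-qⁿ)²`. -/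
noncomputable def Z2 (q : ℝ) : ℝ := ∑' n : ℕ+, q ^ (n : ℕ) / (1 - q ^ (n : ℕ)) ^ 2

/-- Okounkov's `Z(3) = ∑_{n ≥ 1} qⁿ(qⁿ+1)/(1-qⁿ)³`. -/
noncomputable def Z3 (q : ℝ) : ℝ :=
  ∑' n : ℕ+, q ^ (n : ℕ) * (q ^ (n : ℕ) + 1) / (1 - q ^ (n : ℕ)) ^ 3

/-- Okounkov's `Z(4) = ∑_{n ≥ 1} q²ⁿ/(1-qⁿ)⁴`. -/
noncomputable def Z4 (q : ℝ) : ℝ := ∑' n : ℕ+, q ^ (2 * (n : ℕ)) / (1 - q ^ (n : ℕ)) ^ 4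

/-- The hypotheses isolate the partial fraction rule satisfied by `x n = (1 - qⁿ)⁻¹`. -/
theorem sum_antidiagonal_mul_of_partial_fraction {x : ℕ → ℝ} (hx0 : x 0 = 0)
    (hx : ∀ i j, 0 < i → 0 < j → x i * x j = x (i + j) * (x i + x j - 1)) (w : ℕ → ℝ) (N : ℕ) :
    ∑ p ∈ Finset.HasAntidiagonal.antidiagonal N, w p.1 * x p.1 * x p.2
      = x N * ∑ m ∈ Finset.Ico 1 N, w m * (x m + x (N - m) - 1) := by
  rw [Finset.Nat.sum_antidiagonal_eq_sum_range_succ (fun i j => w i * x i * x j),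
    Finset.sum_range_succ, Nat.sub_self, hx0, mul_zero, add_zero, Finset.mul_sum,
    Finset.range_eq_Ico]
  rcases Nat.eq_zero_or_pos N with rfl | hN
  · simp
  rw [Finset.sum_eq_sum_Ico_succ_bot hN, hx0, mul_zero, zero_mul, zero_add]
  refine Finset.sum_congr rfl fun m hm => ?_
  rw [Finset.mem_Ico] at hm
  have h := hx m (N - m) (by omega) (by omega)
  rw [show m + (N - m) = N by omega] at h
  linear_combination w m * h

theorem sum_Ico_one_reflect {x : ℕ → ℝ} (hx0 : x 0 = 0) (N : ℕ) :
    ∑ m ∈ Finset.Ico 1 N, x (N - m) = ∑ m ∈ Finset.range N, x m := by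
  rcases N with _ | n
  · simp
  · rw [Finset.sum_range_succ', hx0, add_zero, ← Finset.sum_range_reflect,
      Finset.sum_Ico_eq_sum_range]
    refine Finset.sum_congr (by simp) fun m hm => ?_
    rw [Finset.mem_range] at hm
    congr 1
    omega

theorem sum_Ico_one_eq_sum_range {x : ℕ → ℝ} (hx0 : x 0 = 0) (N : ℕ) :
    ∑ m ∈ Finset.Ico 1 N, x m = ∑ m ∈ Finset.range N, x m := by
  rcases N with _ | n
  · simp
  · rw [Finset.range_eq_Ico, Finset.sum_eq_sum_Ico_succ_bot n.succ_pos, hx0, zero_add]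

theorem sum_antidiagonal_mul_self {x : ℕ → ℝ} (hx0 : x 0 = 0)
    (hx : ∀ i j, 0 < i → 0 < j → x i * x j = x (i + j) * (x i + x j - 1)) (N : ℕ) :
    ∑ p ∈ Finset.HasAntidiagonal.antidiagonal N, x p.1 * x p.2
      = (2 * ∑ m ∈ Finset.range N, x m - ((N : ℝ) - 1)) * x N := by
  have h := sum_antidiagonal_mul_of_partial_fraction hx0 hx (fun _ => 1) N
  simp only [one_mul] at h
  rw [h, Finset.sum_sub_distrib, Finset.sum_add_distrib, sum_Ico_one_reflect hx0,
    sum_Ico_one_eq_sum_range hx0]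
  rcases N with _ | n
  · simp [hx0]
  · simp
    ring

theorem sum_Ico_weighted_eq {x : ℕ → ℝ} (hx0 : x 0 = 0)
    (hx : ∀ i j, 0 < i → 0 < j → x i * x j = x (i + j) * (x i + x j - 1)) (n : ℕ) :
    ∑ m ∈ Finset.Ico 1 (n + 1), (2 * ∑ a ∈ Finset.range m, x a - ((m : ℝ) - 1))
        * (x m + x (n + 1 - m) - 1)
      = 6 * ∑ m ∈ Finset.range (n + 1), x m * ∑ a ∈ Finset.range m, x a
        - 3 * ((n : ℝ) - 1) * ∑ m ∈ Finset.range (n + 1), x m + n * ((n : ℝ) - 1) / 2 := by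
  set w : ℕ → ℝ := fun m => 2 * ∑ a ∈ Finset.range m, x a - ((m : ℝ) - 1) with hw
  have conv_step (n : ℕ) : ∑ m ∈ Finset.Ico 1 (n + 2), w m * x (n + 2 - m)
      = ∑ m ∈ Finset.Ico 1 (n + 1), w m * x (n + 1 - m) + 2 * (w (n + 1) * x (n + 1))
        - ∑ m ∈ Finset.range (n + 1), x m := by
    have hc := sum_antidiagonal_mul_self hx0 hx (n + 1)
    rw [Finset.Nat.sum_antidiagonal_eq_sum_range_succ (fun i j => x i * x j),
      Finset.sum_range_succ, Nat.sub_self, hx0, mul_zero, add_zero, Finset.range_eq_Ico,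
      Finset.sum_eq_sum_Ico_succ_bot n.succ_pos, hx0, zero_mul, zero_add, ← Finset.range_eq_Ico]
      at hc
    have hw1 : w 1 = 0 := by simp [hw, hx0]
    rw [Finset.sum_eq_sum_Ico_succ_bot (by omega), hw1, zero_mul, zero_add,
      ← Finset.sum_Ico_add' (fun m => w m * x (n + 2 - m)) 1 (n + 1) 1,
      ← sum_Ico_one_reflect hx0 (n + 1), ← hc, Finset.mul_sum, ← Finset.sum_add_distrib,
      ← Finset.sum_sub_distrib]
    refine Finset.sum_congr rfl fun m _ => ?_
    rw [show n + 2 - (m + 1) = n + 1 - m by omega]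
    simp only [hw, Finset.sum_range_succ]
    push_cast
    ring
  induction n with
  | zero => simp [hx0]
  | succ n ih =>
    have split (N : ℕ) : ∑ m ∈ Finset.Ico 1 N, w m * (x m + x (N - m) - 1)
        = ∑ m ∈ Finset.Ico 1 N, w m * x (N - m) + ∑ m ∈ Finset.Ico 1 N, w m * (x m - 1) := by
      rw [← Finset.sum_add_distrib]
      exact Finset.sum_congr rfl fun m _ => by ring
    change ∑ m ∈ Finset.Ico 1 (n + 1), w m * (x m + x (n + 1 - m) - 1) = _ at ih
    change ∑ m ∈ Finset.Ico 1 (n + 2), w m * (x m + x (n + 2 - m) - 1) = _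
    rw [split] at ih
    rw [split, conv_step, Finset.sum_Ico_succ_top (by omega : 1 ≤ n + 1),
      Finset.sum_range_succ _ (n + 1), Finset.sum_range_succ x (n + 1)]
    have hwn : w (n + 1) = 2 * ∑ a ∈ Finset.range (n + 1), x a - n := by simp [hw]
    rw [hwn]
    push_cast
    linear_combination ih

/-- The threefold convolution of `x n = (1 - qⁿ)⁻¹` in terms of truncated multiple sums. -/
theorem sum_antidiagonal_triple {x : ℕ → ℝ} (hx0 : x 0 = 0)
    (hx : ∀ i j, 0 < i → 0 < j → x i * x j = x (i + j) * (x i + x j - 1)) (N : ℕ) :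
    ∑ p ∈ Finset.HasAntidiagonal.antidiagonal N, x p.1 *
          ∑ r ∈ Finset.HasAntidiagonal.antidiagonal p.2, x r.1 * x r.2
      = x N * (6 * ∑ m ∈ Finset.range N, x m * ∑ a ∈ Finset.range m, x a
        - 3 * ((N : ℝ) - 2) * ∑ m ∈ Finset.range N, x m
        + 1 / 2 * (((N : ℝ) - 1) * ((N : ℝ) - 2))) := by
  simp_rw [sum_antidiagonal_mul_self hx0 hx]
  rw [← Finset.Nat.sum_antidiagonal_swap]
  simp only [Prod.fst_swap, Prod.snd_swap, mul_comm (x (Prod.snd _))]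
  rw [sum_antidiagonal_mul_of_partial_fraction hx0 hx
    (fun m => 2 * ∑ a ∈ Finset.range m, x a - ((m : ℝ) - 1))]
  rcases N with _ | n
  · simp [hx0]
  · rw [sum_Ico_weighted_eq hx0 hx]
    push_cast
    ring

theorem tsum_pnat_eq_tsum_nat {f : ℕ → ℝ} (hf : f 0 = 0) : ∑' n : ℕ+, f n = ∑' n, f n := by
  refine PNat.coe_injective.tsum_eq fun n hn => ?_
  have hn0 : n ≠ 0 := by
    rintro rfl
    exact hn hf
  exact ⟨⟨n, Nat.pos_of_ne_zero hn0⟩, rfl⟩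

theorem tsum_tsum_eq_tsum_sum_antidiagonal {f : ℕ × ℕ → ℝ} (hf : Summable f) :
    ∑' i, ∑' j, f (i, j) = ∑' n, ∑ p ∈ Finset.HasAntidiagonal.antidiagonal n, f p := by
  rw [← hf.tsum_prod, ← Finset.HasAntidiagonal.sigmaAntidiagonalEquivProd.tsum_eq f,
    Summable.tsum_sigma (f := fun c => f (Finset.HasAntidiagonal.sigmaAntidiagonalEquivProd c))
      (Finset.HasAntidiagonal.sigmaAntidiagonalEquivProd.summable_iff.mpr hf)]
  refine tsum_congr fun n => ?_
  rw [tsum_fintype]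
  exact Finset.sum_coe_sort (Finset.HasAntidiagonal.antidiagonal n) f

theorem abs_inv_one_sub_pow_le {q : ℝ} (hq : |q| < 1) (n : ℕ) :
    |(1 - q ^ n)⁻¹| ≤ (1 - |q|)⁻¹ := by
  have hpos : 0 < 1 - |q| := by linarith
  rcases Nat.eq_zero_or_pos n with rfl | hn
  · simp only [pow_zero, sub_self, inv_zero, abs_zero]
    positivity
  · rw [abs_inv]
    refine inv_anti₀ hpos ?_
    have h1 : |q| ^ n ≤ |q| := pow_le_of_le_one (abs_nonneg q) hq.le hn.ne'
    have h2 := abs_sub_abs_le_abs_sub 1 (q ^ n)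
    rw [abs_one, abs_pow] at h2
    linarith

theorem inv_one_sub_pow_mul {q : ℝ} (hq : |q| < 1) {i j : ℕ} (hi : 0 < i) (hj : 0 < j) :
    (1 - q ^ i)⁻¹ * (1 - q ^ j)⁻¹
      = (1 - q ^ (i + j))⁻¹ * ((1 - q ^ i)⁻¹ + (1 - q ^ j)⁻¹ - 1) := by
  have hne {n : ℕ} (hn : 0 < n) : 1 - q ^ n ≠ 0 := by
    intro h
    have h1 : |q| ^ n < 1 := pow_lt_one₀ (abs_nonneg q) hq hn.ne'
    rw [← abs_pow, ← sub_eq_zero.mp h, abs_one] at h1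
    exact lt_irrefl _ h1
  have h1 := hne hi
  have h2 := hne hj
  have h3 := hne (Nat.add_pos_left hi j)
  field_simp
  ring

theorem summable_pow_mul_of_abs_le {q : ℝ} (hq : |q| < 1) {f : ℕ → ℝ} {C : ℝ} {d : ℕ}
    (hf : ∀ n, |f n| ≤ C * (n : ℝ) ^ d) : Summable fun n => q ^ n * f n := by
  have hs : Summable fun n : ℕ => C * ((n : ℝ) ^ d * |q| ^ n) :=
    (summable_pow_mul_geometric_of_norm_lt_one d (by simpa using hq)).mul_left C
  refine Summable.of_norm_bounded hs fun n => ?_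
  rw [Real.norm_eq_abs, abs_mul, abs_pow]
  nlinarith [hf n, pow_nonneg (abs_nonneg q) n]

theorem tsum_triple_eq_tsum_sum_antidiagonal {q : ℝ} (hq : |q| < 1) {x : ℕ → ℝ} {K : ℝ}
    (hK : ∀ n, |x n| ≤ K) :
    ∑' i, ∑' j, ∑' k, q ^ (i + j + k) * (x i * x j * x k * x (i + j + k))
      = ∑' n, q ^ n * x n *
        ∑ p ∈ Finset.HasAntidiagonal.antidiagonal n, x p.1 *
          ∑ r ∈ Finset.HasAntidiagonal.antidiagonal p.2, x r.1 * x r.2 := by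
  have hK0 : 0 ≤ K := (abs_nonneg _).trans (hK 0)
  have hgeo : Summable fun n : ℕ => |q| ^ n := summable_geometric_of_lt_one (abs_nonneg q) hq
  have hbound (i j k n : ℕ) : |x i * x j * x k * x n| ≤ K ^ 4 := by
    have h : |x i| * |x j| * |x k| * |x n| ≤ K * K * K * K := by
      gcongr <;> apply hK
    rw [abs_mul, abs_mul, abs_mul]
    linarith
  have hinner (i : ℕ) : ∑' j, ∑' k, q ^ (i + j + k) * (x i * x j * x k * x (i + j + k))
      = ∑' m, ∑ r ∈ Finset.HasAntidiagonal.antidiagonal m,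
          q ^ (i + r.1 + r.2) * (x i * x r.1 * x r.2 * x (i + r.1 + r.2)) := by
    refine tsum_tsum_eq_tsum_sum_antidiagonal
      (f := fun r => q ^ (i + r.1 + r.2) * (x i * x r.1 * x r.2 * x (i + r.1 + r.2))) ?_
    refine Summable.of_norm_bounded ((hgeo.mul_of_nonneg hgeo (fun _ => by positivity)
      (fun _ => by positivity)).mul_left (|q| ^ i * K ^ 4)) fun r => ?_
    rw [Real.norm_eq_abs, abs_mul, abs_pow, pow_add, pow_add]
    have := mul_le_mul_of_nonneg_left (hbound i r.1 r.2 (i + r.1 + r.2))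
      (by positivity : 0 ≤ |q| ^ i * |q| ^ r.1 * |q| ^ r.2)
    linarith
  have hlin : Summable fun m : ℕ => ((m : ℝ) + 1) * |q| ^ m := by
    have h := summable_pow_mul_geometric_of_norm_lt_one 1 (r := |q|) (by simpa using hq)
    refine (h.add hgeo).congr fun m => ?_
    ring
  simp_rw [hinner]
  rw [tsum_tsum_eq_tsum_sum_antidiagonal (f := fun p =>
    ∑ r ∈ Finset.HasAntidiagonal.antidiagonal p.2,
      q ^ (p.1 + r.1 + r.2) * (x p.1 * x r.1 * x r.2 * x (p.1 + r.1 + r.2)))]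
  · refine tsum_congr fun n => ?_
    rw [Finset.mul_sum]
    refine Finset.sum_congr rfl fun p hp => ?_
    rw [Finset.mul_sum, Finset.mul_sum]
    refine Finset.sum_congr rfl fun r hr => ?_
    rw [Finset.HasAntidiagonal.mem_antidiagonal] at hp hr
    rw [show p.1 + r.1 + r.2 = n by omega]
    ring
  · refine Summable.of_norm_bounded ((hgeo.mul_of_nonneg hlin (fun _ => by positivity)
      (fun _ => by positivity)).mul_left (K ^ 4)) fun p => ?_
    have hterm (r : ℕ × ℕ) (hr : r ∈ Finset.HasAntidiagonal.antidiagonal p.2) :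
        ‖q ^ (p.1 + r.1 + r.2) * (x p.1 * x r.1 * x r.2 * x (p.1 + r.1 + r.2))‖
          ≤ |q| ^ (p.1 + p.2) * K ^ 4 := by
      rw [Finset.HasAntidiagonal.mem_antidiagonal] at hr
      rw [Real.norm_eq_abs, abs_mul, abs_pow, add_assoc, hr]
      exact mul_le_mul_of_nonneg_left (hbound _ _ _ _) (by positivity)
    refine (norm_sum_le_of_le _ hterm).trans_eq ?_
    rw [Finset.sum_const, Finset.Nat.card_antidiagonal, nsmul_eq_mul, pow_add]
    push_cast
    ring

theorem tsum_pnat_ite_lt {f : ℕ → ℝ} (hf : f 0 = 0) (N : ℕ) :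
    ∑' n : ℕ+, (if (n : ℕ) < N then f n else 0) = ∑ n ∈ Finset.range N, f n := by
  rw [tsum_pnat_eq_tsum_nat (f := fun n => if n < N then f n else 0) (by simp [hf]),
    tsum_eq_sum (s := Finset.range N) fun n hn => if_neg (by simpa using hn)]
  exact Finset.sum_congr rfl fun n hn => if_pos (Finset.mem_range.mp hn)

theorem T_eq_simplified (q : ℝ) (hq : |q| < 1) :
    (∑' i : ℕ+, ∑' j : ℕ+, ∑' k : ℕ+, q ^ ((i : ℕ) + (j : ℕ) + (k : ℕ)) / ((1 - q ^ (i : ℕ)) * (1 - q ^ (j : ℕ)) * (1 - q ^ (k : ℕ)) * (1 - q ^ ((i : ℕ) + (j : ℕ) + (k : ℕ))))) = 6 * (∑' n₁ : ℕ+, ∑' n₂ : ℕ+, ∑' n₃ : ℕ+, if (n₃ : ℕ) < (n₂ : ℕ) ∧ (n₂ : ℕ) < (n₁ : ℕ) then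
          q ^ (n₁ : ℕ) / ((1 - q ^ (n₁ : ℕ)) ^ 2 * (1 - q ^ (n₂ : ℕ)) * (1 - q ^ (n₃ : ℕ))) else 0)
        - 3 * (∑' n₁ : ℕ+, ∑' n₂ : ℕ+, if (n₂ : ℕ) < (n₁ : ℕ) then
          ((n₁ : ℝ) - 2) * q ^ (n₁ : ℕ) / ((1 - q ^ (n₁ : ℕ)) ^ 2 * (1 - q ^ (n₂ : ℕ))) else 0)
        + 1 / 2 * ∑' n : ℕ+, ((n : ℝ) - 1) * ((n : ℝ) - 2) * q ^ (n : ℕ) / (1 - q ^ (n : ℕ)) ^ 2 := by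
  set x : ℕ → ℝ := fun n => (1 - q ^ n)⁻¹ with hxdef
  have hx0 : x 0 = 0 := by simp [hxdef]
  have hx (i j : ℕ) (hi : 0 < i) (hj : 0 < j) : x i * x j = x (i + j) * (x i + x j - 1) :=
    inv_one_sub_pow_mul hq hi hj
  set K : ℝ := (1 - |q|)⁻¹
  have hK (n : ℕ) : |x n| ≤ K := abs_inv_one_sub_pow_le hq n
  have hK0 : 0 ≤ K := (abs_nonneg _).trans (hK 0)
  set H : ℕ → ℝ := fun N => ∑ m ∈ Finset.range N, x m with hH
  set E : ℕ → ℝ := fun N => ∑ m ∈ Finset.range N, x m * H m with hE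
  have hHb (N : ℕ) : |H N| ≤ N * K := by
    refine (norm_sum_le_of_le (Finset.range N) (f := x) (n := fun _ => K) fun m _ => hK m).trans_eq ?_
    simp
  have hEb (N : ℕ) : |E N| ≤ N * (K * (N * K)) := by
    refine (norm_sum_le_of_le (Finset.range N) (f := fun m => x m * H m)
      (n := fun _ => K * (N * K)) fun m hm => ?_).trans_eq (by simp)
    have hmN : (m : ℝ) ≤ N := by exact_mod_cast (Finset.mem_range.mp hm).le
    rw [Real.norm_eq_abs, abs_mul]
    have : (m : ℝ) * K ≤ N * K := by gcongr
    exact mul_le_mul (hK m) ((hHb m).trans this) (abs_nonneg _) hK0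
  have hx2 (N : ℕ) : |x N ^ 2| ≤ K ^ 2 := by
    rw [abs_pow]
    exact pow_le_pow_left₀ (abs_nonneg _) (hK N) 2
  have hlhs : (∑' i : ℕ+, ∑' j : ℕ+, ∑' k : ℕ+, q ^ ((i : ℕ) + (j : ℕ) + (k : ℕ)) / ((1 - q ^ (i : ℕ)) * (1 - q ^ (j : ℕ)) * (1 - q ^ (k : ℕ)) * (1 - q ^ ((i : ℕ) + (j : ℕ) + (k : ℕ)))))
      = ∑' i, ∑' j, ∑' k, q ^ (i + j + k) * (x i * x j * x k * x (i + j + k)) := by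
    rw [← tsum_pnat_eq_tsum_nat (by simp [hx0])]
    refine tsum_congr fun i => ?_
    rw [← tsum_pnat_eq_tsum_nat (by simp [hx0])]
    refine tsum_congr fun j => ?_
    rw [← tsum_pnat_eq_tsum_nat (by simp [hx0])]
    refine tsum_congr fun k => ?_
    simp only [hxdef, div_eq_mul_inv, mul_inv]
  have hA : (∑' n₁ : ℕ+, ∑' n₂ : ℕ+, ∑' n₃ : ℕ+, if (n₃ : ℕ) < (n₂ : ℕ) ∧ (n₂ : ℕ) < (n₁ : ℕ) then
          q ^ (n₁ : ℕ) / ((1 - q ^ (n₁ : ℕ)) ^ 2 * (1 - q ^ (n₂ : ℕ)) * (1 - q ^ (n₃ : ℕ))) else 0)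
      = ∑' n, q ^ n * (x n ^ 2 * E n) := by
    rw [← tsum_pnat_eq_tsum_nat (by simp [hx0])]
    refine tsum_congr fun n₁ => ?_
    rw [← mul_assoc, hE, Finset.mul_sum, ← tsum_pnat_ite_lt (by simp [hx0])]
    refine tsum_congr fun n₂ => ?_
    split_ifs with h
    · rw [hH, ← mul_assoc, Finset.mul_sum, ← tsum_pnat_ite_lt (by simp [hx0])]
      refine tsum_congr fun n₃ => ?_
      simp only [h, and_true, hxdef, div_eq_mul_inv, mul_inv, inv_pow, mul_assoc]
    · simp [h]
  have hB : (∑' n₁ : ℕ+, ∑' n₂ : ℕ+, if (n₂ : ℕ) < (n₁ : ℕ) then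
          ((n₁ : ℝ) - 2) * q ^ (n₁ : ℕ) / ((1 - q ^ (n₁ : ℕ)) ^ 2 * (1 - q ^ (n₂ : ℕ))) else 0)
      = ∑' n : ℕ, q ^ n * (x n ^ 2 * (((n : ℝ) - 2) * H n)) := by
    rw [← tsum_pnat_eq_tsum_nat (by simp [hx0])]
    refine tsum_congr fun n₁ => ?_
    rw [← mul_assoc, ← mul_assoc, hH, Finset.mul_sum, ← tsum_pnat_ite_lt (by simp [hx0])]
    refine tsum_congr fun n₂ => if_congr Iff.rfl ?_ rfl
    simp only [hxdef, div_eq_mul_inv, mul_inv, inv_pow]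
    ring
  have hC : (∑' n : ℕ+, ((n : ℝ) - 1) * ((n : ℝ) - 2) * q ^ (n : ℕ) / (1 - q ^ (n : ℕ)) ^ 2)
      = ∑' n : ℕ, q ^ n * (x n ^ 2 * (((n : ℝ) - 1) * ((n : ℝ) - 2))) := by
    rw [← tsum_pnat_eq_tsum_nat (by simp [hx0])]
    refine tsum_congr fun n => ?_
    simp only [hxdef, div_eq_mul_inv, inv_pow]
    ring
  have hn1 (n : ℕ) (hn : 1 ≤ n) : |(n : ℝ) - 1| ≤ n ∧ |(n : ℝ) - 2| ≤ n := by
    have : (1 : ℝ) ≤ n := by exact_mod_cast hn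
    constructor <;> rw [abs_le] <;> constructor <;> linarith
  have hsA : Summable fun n => q ^ n * (x n ^ 2 * E n) := by
    refine summable_pow_mul_of_abs_le hq (C := K ^ 4) (d := 2) fun n => ?_
    rw [abs_mul]
    exact (mul_le_mul (hx2 n) (hEb n) (abs_nonneg _) (by positivity)).trans_eq (by ring)
  have hsB : Summable fun n : ℕ => q ^ n * (x n ^ 2 * (((n : ℝ) - 2) * H n)) := by
    refine summable_pow_mul_of_abs_le hq (C := K ^ 3) (d := 2) fun n => ?_
    rcases Nat.eq_zero_or_pos n with rfl | hn
    · simp [hx0]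
    rw [abs_mul, abs_mul]
    exact (mul_le_mul (hx2 n) (mul_le_mul (hn1 n hn).2 (hHb n) (abs_nonneg _) (by positivity))
      (by positivity) (by positivity)).trans_eq (by ring)
  have hsC : Summable fun n : ℕ => q ^ n * (x n ^ 2 * (((n : ℝ) - 1) * ((n : ℝ) - 2))) := by
    refine summable_pow_mul_of_abs_le hq (C := K ^ 2) (d := 2) fun n => ?_
    rcases Nat.eq_zero_or_pos n with rfl | hn
    · simp [hx0]
    rw [abs_mul, abs_mul]
    exact (mul_le_mul (hx2 n) (mul_le_mul (hn1 n hn).1 (hn1 n hn).2 (abs_nonneg _) (by positivity))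
      (by positivity) (by positivity)).trans_eq (by ring)
  rw [hlhs, hA, hB, hC, tsum_triple_eq_tsum_sum_antidiagonal hq hK, ← tsum_mul_left,
    ← tsum_mul_left, ← tsum_mul_left, ← (hsA.mul_left 6).tsum_sub (hsB.mul_left 3),
    ← ((hsA.mul_left 6).sub (hsB.mul_left 3)).tsum_add (hsC.mul_left (1 / 2))]
  refine tsum_congr fun n => ?_
  rw [sum_antidiagonal_triple hx0 hx]
  ring
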